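/- arXiv:1108.1568 — 4 statements merged into one kernel-verified Lean document; each statement's English description precedes it below -/
import Mathlib

section
/- There exists a bijection ψ : ℝ³ → ℝ³ such that both ψ and its inverse are smooth (C^∞), and for every p ∈ ℝ³ and every v ∈ ℝ³ one has α_std(ψ(p))((fderiv ℝ ψ p) v) = α(p)(v); that is, ψ is a diffeomorphism of ℝ³ pulling back the standard contact form dz − y dx to the contact form dz − x dy + y dx. (An explicit witness is ψ(x,y,z) = (x, −2y, z − xy).) -/
/-- The contact form `α = dz − x dy + y dx` on `ℝ³`, as a function of the base
point and the tangent vector. -/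
noncomputable def alphaForm (p : Fin 3 → ℝ) : (Fin 3 → ℝ) →ₗ[ℝ] ℝ :=
  LinearMap.proj 2 - p 0 • LinearMap.proj 1 + p 1 • LinearMap.proj 0

/-- The standard contact form `α_std = dz − y dx` on `ℝ³`. -/
noncomputable def alphaStd (q : Fin 3 → ℝ) : (Fin 3 → ℝ) →ₗ[ℝ] ℝ :=
  LinearMap.proj 2 - q 1 • LinearMap.proj 0

/-- The map `(x, y, z) ↦ (x, −2y, z − xy)`. -/
noncomputable def toStdContact (p : Fin 3 → ℝ) : Fin 3 → ℝ :=
  ![p 0, -2 * p 1, p 2 - p 0 * p 1]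

/-- The inverse `(a, b, c) ↦ (a, −b/2, c − ab/2)` of `toStdContact`. -/
noncomputable def ofStdContact (q : Fin 3 → ℝ) : Fin 3 → ℝ :=
  ![q 0, -q 1 / 2, q 2 - q 0 * q 1 / 2]

theorem leftInverse_ofStdContact : Function.LeftInverse ofStdContact toStdContact := by
  intro p
  ext i
  fin_cases i <;> simp [toStdContact, ofStdContact]
  ring

theorem rightInverse_ofStdContact : Function.RightInverse ofStdContact toStdContact := by
  intro q
  ext i
  fin_cases i <;> simp [toStdContact, ofStdContact] <;> ring

theorem bijective_toStdContact : Function.Bijective toStdContact :=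
  ⟨leftInverse_ofStdContact.injective, rightInverse_ofStdContact.surjective⟩

theorem invFun_toStdContact : Function.invFun toStdContact = ofStdContact :=
  (Function.leftInverse_invFun bijective_toStdContact.injective).eq_rightInverse
    rightInverse_ofStdContact

theorem contDiff_toStdContact {n : WithTop ℕ∞} : ContDiff ℝ n toStdContact := by
  refine contDiff_pi.2 fun i => ?_
  fin_cases i <;> simp [toStdContact] <;> fun_prop

theorem contDiff_ofStdContact {n : WithTop ℕ∞} : ContDiff ℝ n ofStdContact := by
  refine contDiff_pi.2 fun i => ?_
  fin_cases i <;> simp [ofStdContact] <;> fun_prop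

theorem fderiv_toStdContact_apply (p v : Fin 3 → ℝ) :
    fderiv ℝ toStdContact p v = ![v 0, -2 * v 1, v 2 - (p 0 * v 1 + p 1 * v 0)] := by
  have hproj (i : Fin 3) : HasFDerivAt (fun q : Fin 3 → ℝ => q i)
      (ContinuousLinearMap.proj (R := ℝ) (φ := fun _ : Fin 3 => ℝ) i) p :=
    hasFDerivAt_apply i p
  have hdiff : DifferentiableAt ℝ toStdContact p :=
    (contDiff_toStdContact (n := 1)).differentiable one_ne_zero p
  ext i
  refine (congrArg (· v) (fderiv_apply hdiff i)).symm.trans ?_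
  fin_cases i
  · exact congrArg (· v) (hproj 0).fderiv
  · exact congrArg (· v) ((hproj 1).const_mul (-2)).fderiv
  · exact congrArg (· v) ((hproj 2).sub ((hproj 0).mul (hproj 1))).fderiv

/-- There is a diffeomorphism `ψ` of `ℝ³` pulling back the standard contact form
`dz − y dx` to `dz − x dy + y dx`. -/
theorem stmt_0 :
    ∃ ψ : (Fin 3 → ℝ) → (Fin 3 → ℝ),
      Function.Bijective ψ ∧
      ContDiff ℝ (⊤ : ℕ∞) ψ ∧
      ContDiff ℝ (⊤ : ℕ∞) (Function.invFun ψ) ∧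
      ∀ (p v : Fin 3 → ℝ),
        alphaStd (ψ p) (fderiv ℝ ψ p v) = alphaForm p v := by
  refine ⟨toStdContact, bijective_toStdContact, contDiff_toStdContact, ?_, fun p v => ?_⟩
  · rw [invFun_toStdContact]
    exact contDiff_ofStdContact
  · rw [fderiv_toStdContact_apply]
    simp [alphaStd, alphaForm, toStdContact]
    ring
end

section
/- Let A be the free algebra over ℤ/2 on generators a₁,…,a₉, g and let d be the derivation of the knot K, determined by d(a₁) = 1 + a₇·g + a₅·a₆·a₇·g, d(a₂) = 1 + a₉ + a₉·a₆·a₅, d(a₃) = 1 + a₇·a₈, d(a₄) = 1 + a₈·a₉, d = 0 on the other generators. Then every ℤ/2-algebra homomorphism ε : A → ℤ/2 satisfying ε ∘ d = 0 (an augmentation of the DGA) necessarily satisfies ε(a₇) = ε(a₈) = ε(a₉) = ε(g) = 1 and ε(a₅)·ε(a₆) = 0. -/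
/-- Generators of the DGA of the knot `K`: `gen 0, …, gen 8` are the crossings
`a₁, …, a₉`, and `gen 9` is the attaching crossing `γ`. -/
noncomputable def gen (i : Fin 10) : FreeAlgebra (ZMod 2) (Fin 10) :=
  FreeAlgebra.ι (ZMod 2) i

/-- Every augmentation `ε` of the DGA `(A, d)` of the knot `K` satisfies
`ε(a₇) = ε(a₈) = ε(a₉) = ε(g) = 1` and `ε(a₅)·ε(a₆) = 0`. -/
theorem stmt_9
    (d : FreeAlgebra (ZMod 2) (Fin 10) →ₗ[ZMod 2] FreeAlgebra (ZMod 2) (Fin 10))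
    (hleib : ∀ x y, d (x * y) = d x * y + x * d y)
    (h1 : d (gen 0) = 1 + gen 6 * gen 9 + gen 4 * gen 5 * gen 6 * gen 9)
    (h2 : d (gen 1) = 1 + gen 8 + gen 8 * gen 5 * gen 4)
    (h3 : d (gen 2) = 1 + gen 6 * gen 7)
    (h4 : d (gen 3) = 1 + gen 7 * gen 8)
    (h5 : d (gen 4) = 0) (h6 : d (gen 5) = 0) (h7 : d (gen 6) = 0)
    (h8 : d (gen 7) = 0) (h9 : d (gen 8) = 0) (hg : d (gen 9) = 0)
    (ε : FreeAlgebra (ZMod 2) (Fin 10) →ₐ[ZMod 2] ZMod 2)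
    (hε : ∀ x, ε (d x) = 0) :
    ε (gen 6) = 1 ∧ ε (gen 7) = 1 ∧ ε (gen 8) = 1 ∧ ε (gen 9) = 1 ∧
    ε (gen 4) * ε (gen 5) = 0 := by
  have e1 := hε (gen 0)
  have e2 := hε (gen 1)
  have e3 := hε (gen 2)
  have e4 := hε (gen 3)
  simp only [h1, h2, h3, h4, map_add, map_mul, map_one] at e1 e2 e3 e4
  generalize ε (gen 4) = a₅, ε (gen 5) = a₆, ε (gen 6) = a₇, ε (gen 7) = a₈,
    ε (gen 8) = a₉, ε (gen 9) = g at *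
  clear * - e1 e2 e3 e4
  revert a₅ a₆ a₇ a₈ a₉ g
  decide
end

section
/- Let A be the free algebra over ℤ/2 on generators a₁,…,a₉, g and let d' be the derivation of the knot K', determined by d'(a₁) = 1 + a₇·g + a₅·a₆·a₇·g, d'(a₂) = 1 + a₉ + a₉·a₆·a₅·g, d'(a₃) = 1 + a₈·a₇, d'(a₄) = 1 + a₈·a₉, d' = 0 on the other generators. Then every ℤ/2-algebra homomorphism ε : A → ℤ/2 satisfying ε ∘ d' = 0 (an augmentation of the DGA) necessarily satisfies ε(a₇) = ε(a₈) = ε(a₉) = ε(g) = 1 and ε(a₅)·ε(a₆) = 0. -/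
/-- Every augmentation `ε` of the DGA `(A, d')` of the knot `K'` satisfies
`ε(a₇) = ε(a₈) = ε(a₉) = ε(g) = 1` and `ε(a₅)·ε(a₆) = 0`. -/
theorem stmt_10
    (d : FreeAlgebra (ZMod 2) (Fin 10) →ₗ[ZMod 2] FreeAlgebra (ZMod 2) (Fin 10))
    (hleib : ∀ x y, d (x * y) = d x * y + x * d y)
    (h1 : d (gen 0) = 1 + gen 6 * gen 9 + gen 4 * gen 5 * gen 6 * gen 9)
    (h2 : d (gen 1) = 1 + gen 8 + gen 8 * gen 5 * gen 4 * gen 9)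
    (h3 : d (gen 2) = 1 + gen 7 * gen 6)
    (h4 : d (gen 3) = 1 + gen 7 * gen 8)
    (h5 : d (gen 4) = 0) (h6 : d (gen 5) = 0) (h7 : d (gen 6) = 0)
    (h8 : d (gen 7) = 0) (h9 : d (gen 8) = 0) (hg : d (gen 9) = 0)
    (ε : FreeAlgebra (ZMod 2) (Fin 10) →ₐ[ZMod 2] ZMod 2)
    (hε : ∀ x, ε (d x) = 0) :
    ε (gen 6) = 1 ∧ ε (gen 7) = 1 ∧ ε (gen 8) = 1 ∧ ε (gen 9) = 1 ∧
    ε (gen 4) * ε (gen 5) = 0 := by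
  have e1 := hε (gen 0)
  have e2 := hε (gen 1)
  have e3 := hε (gen 2)
  have e4 := hε (gen 3)
  simp only [h1, h2, h3, h4, map_add, map_mul, map_one] at e1 e2 e3 e4
  generalize ε (gen 4) = a₅ at *
  generalize ε (gen 5) = a₆ at *
  generalize ε (gen 6) = a₇ at *
  generalize ε (gen 7) = a₈ at *
  generalize ε (gen 8) = a₉ at *
  generalize ε (gen 9) = g at *
  clear h1 h2 h3 h4 h5 h6 h7 h8 h9 hg hε hleib
  revert a₅ a₆ a₇ a₈ a₉ g
  decide
end

section
/- Let V = (Fin 10 → ZMod 2) with standard basis e₁,…,e₁₀. For any c₅, c₆ ∈ ZMod 2 with c₅·c₆ = 0, let D' : V → V be the ℤ/2-linear map with D'(e₁) = e₇ + c₆·e₅ + c₅·e₆ + c₅·(e₈ + e₉), D'(e₂) = e₉ + e₁₀ + c₆·e₅ + c₅·e₆, D'(e₃) = e₈ + e₇, D'(e₄) = e₉ + e₈, and D'(eᵢ) = 0 for i ∈ {5,…,10} (the linearized differential of the knot K' for the augmentation with ε(a₅) = c₅, ε(a₆) = c₆). Then D' ∘ D' = 0 and the quotient vector space ker D' ⧸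 range D' has dimension 2 over ℤ/2. -/
/-- The standard basis vectors of `V = Fin 10 → ZMod 2` (corresponding to the
generators `α'₁, …, α'₉, γ'` of the DGA of the knot `K'`). -/
noncomputable def e (i : Fin 10) : Fin 10 → ZMod 2 := Pi.single i 1

/-- If `f ∘ f = 0`, then `dim (ker f ⧸ range f) + dim V = 2 * dim (ker f)`. -/
theorem finrank_ker_quotient_range_add {K V : Type*} [Field K] [AddCommGroup V] [Module K V]
    [FiniteDimensional K V] (f : V →ₗ[K] V) (hf : LinearMap.range f ≤ LinearMap.ker f) :
    Module.finrank K
        (LinearMap.ker f ⧸ Submodule.comap (LinearMap.ker f).subtype (LinearMap.range f)) +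
      Module.finrank K V = 2 * Module.finrank K (LinearMap.ker f) := by
  have hquot := Submodule.finrank_quotient_add_finrank
    (Submodule.comap (LinearMap.ker f).subtype (LinearMap.range f))
  have hcomap := (Submodule.comapSubtypeEquivOfLe hf).finrank_eq
  have hnullity := f.finrank_range_add_finrank_ker
  omega

/-- The functions on `Fin n` vanishing at the first `m` indices form a subspace of dimension
`n - m`. -/
theorem finrank_ker_funLeft_castLE {K : Type*} [Field K] {m n : ℕ} (h : m ≤ n) :
    m + Module.finrank K (LinearMap.ker (LinearMap.funLeft K K (Fin.castLE h))) = n := by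
  have hsurj := LinearMap.funLeft_surjective_of_injective K K _ (Fin.castLE_injective h)
  have hnullity := (LinearMap.funLeft K K (Fin.castLE h)).finrank_range_add_finrank_ker
  rwa [LinearMap.range_eq_top.mpr hsurj, finrank_top, Module.finrank_fin_fun,
    Module.finrank_fin_fun] at hnullity

/-- For every augmentation of the DGA of `K'` (parametrized by `c₅, c₆ ∈ ℤ/2`
with `c₅·c₆ = 0`), the corresponding linearized differential `D'` satisfies
`D' ∘ D' = 0` and its homology `ker D' ⧸ range D'` is `2`-dimensional. -/
theorem stmt_13 (c₅ c₆ : ZMod 2) (hc : c₅ * c₆ = 0)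
    (D' : (Fin 10 → ZMod 2) →ₗ[ZMod 2] (Fin 10 → ZMod 2))
    (h1 : D' (e 0) = e 6 + c₆ • e 4 + c₅ • e 5 + c₅ • (e 7 + e 8))
    (h2 : D' (e 1) = e 8 + e 9 + c₆ • e 4 + c₅ • e 5)
    (h3 : D' (e 2) = e 7 + e 6) (h4 : D' (e 3) = e 8 + e 7)
    (h0 : ∀ i : Fin 10, 4 ≤ (i : ℕ) → D' (e i) = 0) :
    (∀ x, D' (D' x) = 0) ∧
    Module.finrank (ZMod 2)
      ((LinearMap.ker D') ⧸
        Submodule.comap (LinearMap.ker D').subtype (LinearMap.range D')) = 2 := by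
  have hD (x : Fin 10 → ZMod 2) :
      D' x = x 0 • D' (e 0) + x 1 • D' (e 1) + x 2 • D' (e 2) + x 3 • D' (e 3) := by
    have hx : x = ∑ i, x i • e i := by simpa [e] using pi_eq_sum_univ' x
    conv_lhs => rw [hx]
    simp only [map_sum, map_smul]
    simp [Fin.sum_univ_succ, h0, add_assoc]
  have hker : LinearMap.ker D' =
      LinearMap.ker (LinearMap.funLeft (ZMod 2) (ZMod 2) (Fin.castLE (by decide : 4 ≤ 10))) := by
    ext x
    simp only [LinearMap.mem_ker]
    constructor
    · intro hx
      rw [hD, h1, h2, h3, h4] at hx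
      have hx6 := congrFun hx 6
      have hx7 := congrFun hx 7
      have hx8 := congrFun hx 8
      have hx9 := congrFun hx 9
      simp [e] at hx6 hx7 hx8 hx9
      ext i
      fin_cases i <;> simp [LinearMap.funLeft_apply] <;> grind
    · intro hx
      have hx' (i : Fin 4) : x (Fin.castLE (by decide) i) = 0 := congrFun hx i
      have hx0 : x 0 = 0 := hx' 0
      have hx1 : x 1 = 0 := hx' 1
      have hx2 : x 2 = 0 := hx' 2
      have hx3 : x 3 = 0 := hx' 3
      simp [hD x, hx0, hx1, hx2, hx3]
  have hsq (x : Fin 10 → ZMod 2) : D' (D' x) = 0 := by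
    simp [hD x, h1, h2, h3, h4, h0]
  refine ⟨hsq, ?_⟩
  have hhom := finrank_ker_quotient_range_add D' (by rintro _ ⟨x, rfl⟩; exact hsq x)
  have hdim := finrank_ker_funLeft_castLE (K := ZMod 2) (by decide : 4 ≤ 10)
  rw [← hker] at hdim
  rw [Module.finrank_fin_fun] at hhom
  omega
end
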